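/- Let 1 < p < 2. For every q > 2p/(2−p) there exists s̄ ∈ (0,1) such that for every α ∈ (0,π) and every s ∈ (0,s̄), any classical solution u of div(|∇u|^{p−2}∇u) + |u|^{q−2}u = 0 on the domain Ω₂^{α,s} with zero boundary values is identically zero. -/

import Mathlib

open Real MeasureTheory

noncomputable section

/-- The gradient of a function `u : ℂ → ℝ`, where `ℂ` is identified with `ℝ²`:
the vector of the two partial derivatives. -/
def grad (u : ℂ → ℝ) (z : ℂ) : ℂ := ⟨fderiv ℝ u z 1, fderiv ℝ u z Complex.I⟩

/-- The divergence of a vector field `A : ℂ → ℂ`, where `ℂ` is identified with `ℝ²`: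
`div A = ∂₁A₁ + ∂₂A₂`. -/
def divg (A : ℂ → ℂ) (z : ℂ) : ℝ := (fderiv ℝ A z 1).re + (fderiv ℝ A z Complex.I).im

/-- The domain `Ω₂^{α,s} = {(ρ cos θ, ρ sin θ) : |θ| < α, |ρ - 1| < s} ⊆ ℝ² ≅ ℂ`. -/
def Omega2 (α s : ℝ) : Set ℂ :=
  {z | ∃ ρ θ : ℝ, |θ| < α ∧ |ρ - 1| < s ∧ z = (ρ : ℂ) * Complex.exp (θ * Complex.I)}

/-- A classical solution of `div(|∇u|^{p-2}∇u) + f(u) = 0` on `Ω` with zero boundary values: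
`u` is continuous on the closure of `Ω`, vanishes on the boundary of `Ω`, is continuously
differentiable on `Ω`, the field `A = ‖∇u‖^{p-2}∇u` (equal to `0` where `∇u = 0`, as the
real power `0 ^ (p-2)` is `0` for `p ≠ 2`) is continuously differentiable on `Ω` and satisfies
`div A + f(u) = 0` on `Ω`, and `‖∇u‖^p` is integrable on `Ω`. -/
structure IsClassicalSolution (p : ℝ) (f : ℝ → ℝ) (Ω : Set ℂ) (u : ℂ → ℝ) : Prop where
  contOn : ContinuousOn u (closure Ω)
  boundary : ∀ z ∈ frontier Ω, u z = 0
  contDiffOn : ContDiffOn ℝ 1 u Ω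
  fieldContDiffOn : ContDiffOn ℝ 1 (fun z => (‖grad u z‖ ^ (p - 2) : ℝ) • grad u z) Ω
  pde : ∀ z ∈ Ω, divg (fun w => (‖grad u w‖ ^ (p - 2) : ℝ) • grad u w) z + f (u z) = 0
  integrable : IntegrableOn (fun z => ‖grad u z‖ ^ p) Ω volume


open Set Filter Topology

/-! ### Elementary inequalities -/

/-- Young inequality in the form used for convexity. -/
lemma young_aux {m : ℝ} (hm : 1 < m) {a b : ℝ} (ha : 0 ≤ a) (hb : 0 ≤ b) :
    b ^ (m - 1) * a ≤ a ^ m / m + (1 - 1 / m) * b ^ m := by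
  have hc : m.HolderConjugate (m / (m - 1)) := by
    rw [Real.holderConjugate_iff]
    refine ⟨hm, ?_⟩
    have : m - 1 ≠ 0 := by linarith
    field_simp
    ring
  have h := Real.young_inequality_of_nonneg ha (Real.rpow_nonneg hb (m - 1)) hc
  rw [← Real.rpow_mul hb] at h
  have h1 : (m - 1) * (m / (m - 1)) = m := by
    have : m - 1 ≠ 0 := by linarith
    field_simp
  rw [h1] at h
  have h2 : b ^ m / (m / (m - 1)) = (1 - 1 / m) * b ^ m := by
    have : m - 1 ≠ 0 := by linarith
    field_simp
  rw [h2] at h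
  linarith

lemma rpow_sub_two_mul_sq {m : ℝ} (hm : 0 < m) {a : ℝ} (ha : 0 ≤ a) :
    a ^ (m - 2) * a ^ 2 = a ^ m := by
  rcases ha.eq_or_lt with h | h
  · subst h
    simp [Real.zero_rpow hm.ne']
  · rw [← Real.rpow_natCast, ← Real.rpow_add h]
    norm_num

lemma rpow_sub_two_mul_self {m : ℝ} (hm : 1 < m) {a : ℝ} (ha : 0 ≤ a) :
    a ^ (m - 2) * a = a ^ (m - 1) := by
  rcases ha.eq_or_lt with h | h
  · subst h
    simp [Real.zero_rpow (show m - 1 ≠ 0 by linarith)]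
  · nth_rewrite 2 [← Real.rpow_one a]
    rw [← Real.rpow_add h]
    congr 1
    ring

/-- The power nonlinearity. -/
def pf (q t : ℝ) : ℝ := |t| ^ (q - 2) * t

lemma pf_mul_self {q : ℝ} (hq : 2 < q) (t : ℝ) : pf q t * t = |t| ^ q := by
  unfold pf
  rw [mul_assoc, ← sq, ← sq_abs, rpow_sub_two_mul_sq (by linarith) (abs_nonneg t)]

lemma pf_continuous {q : ℝ} (hq : 2 < q) : Continuous (pf q) := by
  unfold pf
  exact (continuous_abs.rpow_const (fun x => Or.inr (by linarith))).mul continuous_id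

lemma pf_zero (q : ℝ) : pf q 0 = 0 := by simp [pf]

lemma pf_convex {q : ℝ} (hq : 2 < q) (a b : ℝ) :
    |b| ^ q / q - |a| ^ q / q - |pf q b - pf q a| * |b - a| ≤ pf q a * (b - a) := by
  have h1 : pf q b * a ≤ |a| ^ q / q + (1 - 1 / q) * |b| ^ q := by
    have := young_aux (m := q) (by linarith) (abs_nonneg a) (abs_nonneg b)
    refine le_trans ?_ this
    rw [← rpow_sub_two_mul_self (by linarith) (abs_nonneg b), ]
    refine (le_abs_self _).trans (le_of_eq ?_)
    rw [abs_mul, pf, abs_mul, abs_of_nonneg (Real.rpow_nonneg (abs_nonneg b) _)]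
  have h2 := pf_mul_self hq b
  have h3 : (pf q b - pf q a) * (b - a) ≤ |pf q b - pf q a| * |b - a| := by
    rw [← abs_mul]; exact le_abs_self _
  have h4 : (1 - 1 / q) * |b| ^ q = |b| ^ q - |b| ^ q / q := by ring
  nlinarith

lemma cs_aux {m : ℝ} (hm : 1 < m) (g h : ℂ) :
    ‖g‖ ^ (m - 2) * (g.re * h.re + g.im * h.im) ≤ ‖h‖ ^ m / m + (1 - 1 / m) * ‖g‖ ^ m := by
  have h1 := young_aux hm (norm_nonneg h) (norm_nonneg g)
  refine le_trans ?_ h1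
  rw [← rpow_sub_two_mul_self hm (norm_nonneg g), mul_assoc]
  refine mul_le_mul_of_nonneg_left ?_ (Real.rpow_nonneg (norm_nonneg g) _)
  have := real_inner_le_norm g h
  refine le_trans (le_of_eq ?_) this
  rw [Complex.inner]
  simp
  try ring

/-! ### Truncation -/

/-- Cutoff. -/
def ck (ε t : ℝ) : ℝ := min 1 (max 0 (|t| / ε - 1))

/-- Truncation: a `C¹` function vanishing for `|t| ≤ ε`. -/
def cG (ε t : ℝ) : ℝ := ∫ τ in (0:ℝ)..t, ck ε τ

lemma ck_continuous (ε : ℝ) : Continuous (ck ε) := by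
  unfold ck; fun_prop

lemma ck_nonneg (ε t : ℝ) : 0 ≤ ck ε t := by
  unfold ck; exact le_min zero_le_one (le_max_left _ _)

lemma ck_le_one (ε t : ℝ) : ck ε t ≤ 1 := by
  unfold ck; exact min_le_left _ _

lemma ck_eq_zero {ε t : ℝ} (hε : 0 < ε) (h : |t| ≤ ε) : ck ε t = 0 := by
  unfold ck
  have : |t| / ε - 1 ≤ 0 := by
    rw [sub_nonpos, div_le_one hε]; exact h
  rw [max_eq_left this]; simp

lemma cG_hasDerivAt (ε t : ℝ) : HasDerivAt (cG ε) (ck ε t) t :=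
  ((ck_continuous ε).integral_hasStrictDerivAt 0 t).hasDerivAt

lemma cG_contDiff (ε : ℝ) : ContDiff ℝ 1 (cG ε) := by
  rw [contDiff_one_iff_deriv]
  refine ⟨fun t => (cG_hasDerivAt ε t).differentiableAt, ?_⟩
  have : deriv (cG ε) = ck ε := funext fun t => (cG_hasDerivAt ε t).deriv
  rw [this]; exact ck_continuous ε

lemma cG_eq_zero {ε t : ℝ} (hε : 0 < ε) (h : |t| ≤ ε) : cG ε t = 0 := by
  unfold cG
  rw [intervalIntegral.integral_congr (g := fun _ => (0:ℝ))]
  · simp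
  · intro x hx
    apply ck_eq_zero hε
    refine le_trans ?_ h
    have := abs_sub_left_of_mem_uIcc hx
    simpa using this

lemma cG_abs_le (ε t : ℝ) : |cG ε t| ≤ |t| := by
  unfold cG
  have := intervalIntegral.norm_integral_le_of_norm_le_const (f := ck ε) (a := 0) (b := t) (C := 1)
    (fun x _ => by rw [Real.norm_of_nonneg (ck_nonneg ε x)]; exact ck_le_one ε x)
  simpa using this

/-- The sequence of truncation levels. -/
def eps (n : ℕ) : ℝ := 1 / ((n : ℝ) + 1)

lemma eps_pos (n : ℕ) : 0 < eps n := by unfold eps; positivity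

lemma eps_tendsto : Tendsto eps atTop (𝓝 0) := tendsto_one_div_add_atTop_nhds_zero_nat

lemma ck_tendsto {t : ℝ} (ht : t ≠ 0) : Tendsto (fun n => ck (eps n) t) atTop (𝓝 1) := by
  have hpos : 0 < |t| / 2 := by positivity
  have : ∀ᶠ n in atTop, ck (eps n) t = 1 := by
    filter_upwards [eps_tendsto.eventually (gt_mem_nhds hpos)] with n hn
    unfold ck
    have h1 : 2 ≤ |t| / eps n := by
      rw [le_div_iff₀ (eps_pos n)]; linarith
    apply min_eq_left
    exact le_trans (by linarith) (le_max_right _ _)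
  exact tendsto_const_nhds.congr' (this.mono fun n hn => hn.symm)

lemma cG_tendsto (t : ℝ) : Tendsto (fun n => cG (eps n) t) atTop (𝓝 t) := by
  have h := intervalIntegral.tendsto_integral_filter_of_dominated_convergence (μ := volume)
    (a := 0) (b := t) (l := atTop) (F := fun n => ck (eps n)) (f := fun _ => (1:ℝ))
    (fun _ => (1:ℝ))
    (Eventually.of_forall fun n => (ck_continuous _).aestronglyMeasurable)
    (Eventually.of_forall fun n => Eventually.of_forall fun x _ => by
      rw [Real.norm_of_nonneg (ck_nonneg _ x)]; exact ck_le_one _ x)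
    (by simp)
    (by
      have : ∀ᵐ x : ℝ ∂volume, x ≠ 0 := by
        simp [ae_iff]
      filter_upwards [this] with x hx _
      exact ck_tendsto hx)
  simpa [cG] using h

/-! ### The problem on the rectangle -/

/-- The coordinate rectangle. -/
def Rect (s α : ℝ) : Set (ℝ × ℝ) := Ioo (-s) s ×ˢ Ioo (-α) α

/-- The gradient in polar coordinates (centered at radius `1`). -/
def gw (φ : ℝ × ℝ → ℝ) (x : ℝ × ℝ) : ℂ :=
  ⟨fderiv ℝ φ x (1, 0), fderiv ℝ φ x (0, 1) / (1 + x.1)⟩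

/-- The problem transported to the rectangle. -/
structure RectSol (p q κ s α : ℝ) (v V1 V2 : ℝ × ℝ → ℝ) : Prop where
  hp1 : 1 < p
  hp2 : p < 2
  hq : 2 < q
  hs0 : 0 < s
  hs1 : s < 1
  hα : 0 < α
  hκ0 : 0 < κ
  hκ1 : κ < 1
  hκ : ∀ r, |r| < s → |r| ≤ κ * (1 + r)
  cont : Continuous v
  zero : ∀ x, x ∉ Rect s α → v x = 0
  cd : ContDiffOn ℝ 1 v (Rect s α)
  V1cd : ContDiffOn ℝ 1 V1 (Rect s α)
  V2cd : ContDiffOn ℝ 1 V2 (Rect s α)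
  V1eq : ∀ x ∈ Rect s α, V1 x = (1 + x.1) * (‖gw v x‖ ^ (p - 2) * (gw v x).re)
  V2eq : ∀ x ∈ Rect s α, V2 x = ‖gw v x‖ ^ (p - 2) * (gw v x).im
  div : ∀ x ∈ Rect s α, fderiv ℝ V1 x (1, 0) + fderiv ℝ V2 x (0, 1) = -((1 + x.1) * pf q (v x))
  int : IntegrableOn (fun x => (1 + x.1) * ‖gw v x‖ ^ p) (Rect s α)

lemma isOpen_Rect (s α : ℝ) : IsOpen (Rect s α) := isOpen_Ioo.prod isOpen_Ioo

lemma measurableSet_Rect (s α : ℝ) : MeasurableSet (Rect s α) := (isOpen_Rect s α).measurableSet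

lemma isBounded_Rect (s α : ℝ) : Bornology.IsBounded (Rect s α) :=
  (Metric.isBounded_Ioo _ _).prod (Metric.isBounded_Ioo _ _)

lemma hcs_of_tsupport {s α : ℝ} {φ : ℝ × ℝ → ℝ} (h : tsupport φ ⊆ Rect s α) :
    HasCompactSupport φ :=
  Metric.isCompact_of_isClosed_isBounded (isClosed_tsupport φ) ((isBounded_Rect s α).subset h)

instance (s α : ℝ) : IsFiniteMeasure ((volume : Measure (ℝ × ℝ)).restrict (Rect s α)) :=
  ⟨by
    rw [Measure.restrict_apply_univ]
    exact (isBounded_Rect s α).measure_lt_top⟩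

/-- Continuity of a product with a compactly supported factor. -/
lemma continuous_mul_of_tsupport {U : Set (ℝ × ℝ)} (hU : IsOpen U) {f φ : ℝ × ℝ → ℝ}
    (hf : ContinuousOn f U) (hφ : Continuous φ) (hs : tsupport φ ⊆ U) :
    Continuous (fun x => f x * φ x) := by
  rw [continuous_iff_continuousAt]
  intro x
  by_cases hx : x ∈ U
  · exact (hf.continuousAt (hU.mem_nhds hx)).mul hφ.continuousAt
  · have hx' : x ∉ tsupport φ := fun h => hx (hs h)
    have : (fun x => f x * φ x) =ᶠ[𝓝 x] fun _ => 0 := by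
      have := notMem_tsupport_iff_eventuallyEq.1 hx'
      filter_upwards [this] with y hy
      simp [hy]
    exact continuousAt_const.congr this.symm

lemma ibp_aux {s α : ℝ} {V φ : ℝ × ℝ → ℝ} (hV : ContDiffOn ℝ 1 V (Rect s α))
    (hφ : ContDiff ℝ 1 φ) (hs : tsupport φ ⊆ Rect s α) (e : ℝ × ℝ) :
    Integrable (fun x => V x * fderiv ℝ φ x e) ∧ Integrable (fun x => fderiv ℝ V x e * φ x) ∧
    ∫ x, V x * fderiv ℝ φ x e = - ∫ x, fderiv ℝ V x e * φ x := by
  have hU := isOpen_Rect s α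
  have hcs := hcs_of_tsupport hs
  have hdφ : Continuous (fun x => fderiv ℝ φ x e) :=
    (hφ.continuous_fderiv (by simp)).clm_apply continuous_const
  have hdV : ContinuousOn (fun x => fderiv ℝ V x e) (Rect s α) :=
    (hV.continuousOn_fderiv_of_isOpen hU (by simp)).clm_apply continuousOn_const
  have hsd : tsupport (fun x => fderiv ℝ φ x e) ⊆ Rect s α := by
    refine subset_trans ?_ hs
    exact tsupport_fderiv_apply_subset ℝ e
  have i1 : Integrable (fun x => V x * fderiv ℝ φ x e) :=
    (continuous_mul_of_tsupport hU hV.continuousOn hdφ hsd).integrable_of_hasCompactSupport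
      ((hcs_of_tsupport hsd).mul_left)
  have i2 : Integrable (fun x => fderiv ℝ V x e * φ x) :=
    (continuous_mul_of_tsupport hU hdV hφ.continuous hs).integrable_of_hasCompactSupport
      (hcs.mul_left)
  have i3 : Integrable (fun x => V x * φ x) :=
    (continuous_mul_of_tsupport hU hV.continuousOn hφ.continuous hs).integrable_of_hasCompactSupport
      (hcs.mul_left)
  refine ⟨i1, i2, ?_⟩
  apply integral_mul_fderiv_eq_neg_fderiv_mul_of_integrable i2 i1 i3
  · intro x hx
    exact (hV.contDiffAt (hU.mem_nhds (hs hx))).differentiableAt (by simp)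
  · intro x _
    exact hφ.contDiffAt.differentiableAt (by simp)

section
variable {p q κ s α : ℝ} {v V1 V2 : ℝ × ℝ → ℝ}

lemma RectSol.one_add_pos (h : RectSol p q κ s α v V1 V2) {x : ℝ × ℝ} (hx : x ∈ Rect s α) :
    0 < 1 + x.1 := by
  have := hx.1.1
  have := h.hs1
  linarith

lemma RectSol.one_add_lt (h : RectSol p q κ s α v V1 V2) {x : ℝ × ℝ} (hx : x ∈ Rect s α) :
    1 + x.1 < 2 := by
  have := hx.1.2
  have := h.hs1
  linarith

lemma fderiv_zero_off {φ : ℝ × ℝ → ℝ} (hs : tsupport φ ⊆ Rect s α) {x : ℝ × ℝ}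
    (hx : x ∉ Rect s α) : fderiv ℝ φ x = 0 := by
  have : x ∉ tsupport (fderiv ℝ φ) := fun h => hx (hs (tsupport_fderiv_subset ℝ h))
  exact image_eq_zero_of_notMem_tsupport this

lemma RectSol.test (h : RectSol p q κ s α v V1 V2) {φ : ℝ × ℝ → ℝ}
    (hφ : ContDiff ℝ 1 φ) (hs : tsupport φ ⊆ Rect s α) :
    IntegrableOn (fun x => V1 x * fderiv ℝ φ x (1, 0) + V2 x * fderiv ℝ φ x (0, 1)) (Rect s α) ∧
    ∫ x in Rect s α, (V1 x * fderiv ℝ φ x (1, 0) + V2 x * fderiv ℝ φ x (0, 1)) =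
      ∫ x in Rect s α, (1 + x.1) * pf q (v x) * φ x := by
  obtain ⟨a1, a2, a3⟩ := ibp_aux h.V1cd hφ hs (1, 0)
  obtain ⟨b1, b2, b3⟩ := ibp_aux h.V2cd hφ hs (0, 1)
  refine ⟨(a1.add b1).integrableOn, ?_⟩
  have e1 : ∫ x in Rect s α, (V1 x * fderiv ℝ φ x (1, 0) + V2 x * fderiv ℝ φ x (0, 1)) =
      ∫ x, (V1 x * fderiv ℝ φ x (1, 0) + V2 x * fderiv ℝ φ x (0, 1)) := by
    apply setIntegral_eq_integral_of_forall_compl_eq_zero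
    intro x hx
    simp [fderiv_zero_off hs hx]
  rw [e1, integral_add a1 b1, a3, b3, ← neg_add, ← integral_add a2 b2, ← integral_neg]
  have e2 : ∫ x in Rect s α, (1 + x.1) * pf q (v x) * φ x =
      ∫ x, (1 + x.1) * pf q (v x) * φ x := by
    apply setIntegral_eq_integral_of_forall_compl_eq_zero
    intro x hx
    have : φ x = 0 := image_eq_zero_of_notMem_tsupport (fun h => hx (hs h))
    simp [this]
  rw [e2]
  congr 1
  ext x
  by_cases hx : x ∈ Rect s α
  · have := h.div x hx
    rw [← add_mul, this]; ring
  · have : φ x = 0 := image_eq_zero_of_notMem_tsupport (fun h => hx (hs h))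
    simp [this]

/-- The truncated solution. -/
def psi (v : ℝ × ℝ → ℝ) (n : ℕ) (x : ℝ × ℝ) : ℝ := cG (eps n) (v x)

lemma RectSol.psi_tsupport (h : RectSol p q κ s α v V1 V2) (n : ℕ) :
    tsupport (psi v n) ⊆ Rect s α := by
  have h1 : tsupport (psi v n) ⊆ {x | eps n ≤ |v x|} := by
    apply closure_minimal
    · intro x hx
      by_contra hlt
      simp only [mem_ofPred_eq, not_le] at hlt
      exact hx (cG_eq_zero (eps_pos n) hlt.le)
    · exact isClosed_le continuous_const h.cont.abs
  intro x hx
  by_contra hn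
  have := h1 hx
  simp only [mem_ofPred_eq, h.zero x hn, abs_zero] at this
  exact absurd (eps_pos n) (not_lt.2 this)

lemma RectSol.v_at (h : RectSol p q κ s α v V1 V2) {x : ℝ × ℝ} (hx : x ∈ Rect s α) :
    ContDiffAt ℝ 1 v x := h.cd.contDiffAt ((isOpen_Rect s α).mem_nhds hx)

lemma RectSol.psi_contDiff (h : RectSol p q κ s α v V1 V2) (n : ℕ) :
    ContDiff ℝ 1 (psi v n) := by
  rw [contDiff_iff_contDiffAt]
  intro x
  by_cases hx : x ∈ Rect s α
  · exact (cG_contDiff (eps n)).contDiffAt.comp x (h.v_at hx)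
  · have hx' : x ∉ tsupport (psi v n) := fun h' => hx (h.psi_tsupport n h')
    exact contDiffAt_const.congr_of_eventuallyEq (notMem_tsupport_iff_eventuallyEq.1 hx')

lemma RectSol.psi_fderiv (h : RectSol p q κ s α v V1 V2) (n : ℕ) {x : ℝ × ℝ}
    (hx : x ∈ Rect s α) : fderiv ℝ (psi v n) x = ck (eps n) (v x) • fderiv ℝ v x := by
  have h1 := ((h.v_at hx).differentiableAt (by simp)).hasFDerivAt
  exact ((cG_hasDerivAt (eps n) (v x)).comp_hasFDerivAt x h1).fderiv

lemma RectSol.gw_psi (h : RectSol p q κ s α v V1 V2) (n : ℕ) {x : ℝ × ℝ}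
    (hx : x ∈ Rect s α) : gw (psi v n) x = (ck (eps n) (v x) : ℝ) • gw v x := by
  unfold gw
  rw [h.psi_fderiv n hx]
  apply Complex.ext <;> simp
  ring

lemma RectSol.pair_self (h : RectSol p q κ s α v V1 V2) {x : ℝ × ℝ} (hx : x ∈ Rect s α) :
    V1 x * fderiv ℝ v x (1, 0) + V2 x * fderiv ℝ v x (0, 1) = (1 + x.1) * ‖gw v x‖ ^ p := by
  have hpos := h.one_add_pos hx
  rw [h.V1eq x hx, h.V2eq x hx, ← rpow_sub_two_mul_sq (m := p) (by linarith [h.hp1]) (norm_nonneg (gw v x)),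
    Complex.sq_norm, Complex.normSq_apply]
  have h1 : fderiv ℝ v x (1, 0) = (gw v x).re := rfl
  have h2 : fderiv ℝ v x (0, 1) = (1 + x.1) * (gw v x).im := by
    simp only [gw]; field_simp
  rw [h1, h2]; ring

lemma RectSol.pair_le (h : RectSol p q κ s α v V1 V2) {x : ℝ × ℝ} (hx : x ∈ Rect s α)
    (φ : ℝ × ℝ → ℝ) :
    V1 x * fderiv ℝ φ x (1, 0) + V2 x * fderiv ℝ φ x (0, 1) ≤
      (1 + x.1) * ‖gw φ x‖ ^ p / p + (1 - 1 / p) * ((1 + x.1) * ‖gw v x‖ ^ p) := by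
  have hpos := h.one_add_pos hx
  have h0 := mul_le_mul_of_nonneg_left (cs_aux h.hp1 (gw v x) (gw φ x)) hpos.le
  have h1 : fderiv ℝ φ x (1, 0) = (gw φ x).re := rfl
  have h2 : fderiv ℝ φ x (0, 1) = (1 + x.1) * (gw φ x).im := by
    simp only [gw]; field_simp
  rw [h.V1eq x hx, h.V2eq x hx, h1, h2]
  calc _ = (1 + x.1) * (‖gw v x‖ ^ (p - 2) *
        ((gw v x).re * (gw φ x).re + (gw v x).im * (gw φ x).im)) := by ring
    _ ≤ _ := h0
    _ = _ := by ring

lemma RectSol.gw_meas (h : RectSol p q κ s α v V1 V2) : ContinuousOn (gw v) (Rect s α) := by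
  have hd := h.cd.continuousOn_fderiv_of_isOpen (isOpen_Rect s α) le_rfl
  have e : gw v = fun x => ((fderiv ℝ v x (1, 0) : ℝ) : ℂ) +
      ((fderiv ℝ v x (0, 1) / (1 + x.1) : ℝ) : ℂ) * Complex.I := by
    ext x
    exact Complex.mk_eq_add_mul_I _ _
  rw [e]
  have c1 : ContinuousOn (fun x => fderiv ℝ v x (1, 0)) (Rect s α) :=
    hd.clm_apply continuousOn_const
  have c2 : ContinuousOn (fun x => fderiv ℝ v x (0, 1) / (1 + x.1)) (Rect s α) :=
    (hd.clm_apply continuousOn_const).div (by fun_prop) (fun x hx => (h.one_add_pos hx).ne')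
  exact (Complex.continuous_ofReal.comp_continuousOn c1).add
    ((Complex.continuous_ofReal.comp_continuousOn c2).mul continuousOn_const)

end

section
variable {p q κ s α : ℝ} {v V1 V2 : ℝ × ℝ → ℝ}

/-- On its zero set, the derivative of `v` vanishes almost everywhere. -/
lemma RectSol.null_aux (h : RectSol p q κ s α v V1 V2) (e : ℝ × ℝ) :
    ∀ᵐ x, x ∈ Rect s α → v x = 0 → fderiv ℝ v x e = 0 := by
  have hm : MeasurableSet {x | x ∈ Rect s α → v x = 0 → fderiv ℝ v x e = 0} := by
    have m1 : MeasurableSet {x | fderiv ℝ v x e = 0} :=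
      measurableSet_eq_fun (measurable_fderiv_apply_const ℝ v e) measurable_const
    have m2 : MeasurableSet {x | v x = 0} :=
      measurableSet_eq_fun h.cont.measurable measurable_const
    have : {x | x ∈ Rect s α → v x = 0 → fderiv ℝ v x e = 0} =
        (Rect s α)ᶜ ∪ ({x | v x = 0}ᶜ ∪ {x | fderiv ℝ v x e = 0}) := by
      ext x
      simp only [mem_ofPred_eq, mem_union, mem_compl_iff]
      tauto
    rw [this]
    exact (measurableSet_Rect s α).compl.union (m2.compl.union m1)
  have := ae_mem_of_ae_add_linearMap_mem (LinearMap.toSpanSingleton ℝ (ℝ × ℝ) e)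
    (volume : Measure ℝ) (volume : Measure (ℝ × ℝ)) hm ?_
  · exact this
  intro y
  set T : Set ℝ := {t | y + t • e ∈ Rect s α ∧ v (y + t • e) = 0 ∧ fderiv ℝ v (y + t • e) e ≠ 0}
    with hT
  have hc : T.Countable := by
    refine (countable_setOfPred_isolated_right_within (s := T)).mono ?_
    intro t ht
    refine ⟨ht, ?_⟩
    have h1 : HasFDerivAt v (fderiv ℝ v (y + t • e)) (y + t • e) :=
      ((h.v_at ht.1).differentiableAt (by simp)).hasFDerivAt
    have h2 : HasDerivAt (fun τ : ℝ => y + τ • e) e t := by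
      simpa using ((hasDerivAt_id t).smul_const e).const_add y
    have h3 := h1.comp_hasDerivAt t h2
    have h4 := h3.eventually_ne (c := 0) ht.2.2
    have h5 : ∀ᶠ z in 𝓝[T ∩ Ioi t] t, False := by
      have hle : 𝓝[T ∩ Ioi t] t ≤ 𝓝[≠] t :=
        nhdsWithin_mono t (fun z hz => (ne_of_gt hz.2 : z ≠ t))
      filter_upwards [hle h4, self_mem_nhdsWithin] with z hz hz'
      exact hz hz'.1.2.1
    simpa using h5
  have hz : volume T = 0 := hc.measure_zero _
  have : ∀ᵐ t : ℝ, t ∉ T := measure_eq_zero_iff_ae_notMem.1 hz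
  filter_upwards [this] with t ht
  intro h1 h2
  by_contra h3
  exact ht ⟨h1, h2, h3⟩

lemma RectSol.null (h : RectSol p q κ s α v V1 V2) :
    ∀ᵐ x, x ∈ Rect s α → v x = 0 → gw v x = 0 := by
  filter_upwards [h.null_aux (1, 0), h.null_aux (0, 1)] with x h1 h2 hx hv
  unfold gw
  rw [h1 hx hv, h2 hx hv]
  apply Complex.ext <;> simp

lemma cont_int {f : ℝ × ℝ → ℝ} (hf : Continuous f) (s α : ℝ) : IntegrableOn f (Rect s α) :=
  (hf.continuousOn.integrableOn_compact
    (Metric.isCompact_of_isClosed_isBounded isClosed_closure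
      (isBounded_Rect s α).closure)).mono_set subset_closure

/-- Gradient energy. -/
def EG (p s α : ℝ) (v : ℝ × ℝ → ℝ) : ℝ := ∫ x in Rect s α, (1 + x.1) * ‖gw v x‖ ^ p

/-- Potential energy. -/
def EH (q s α : ℝ) (v : ℝ × ℝ → ℝ) : ℝ := ∫ x in Rect s α, (1 + x.1) * |v x| ^ q

lemma RectSol.cpf (h : RectSol p q κ s α v V1 V2) : Continuous (fun x => pf q (v x)) :=
  (pf_continuous h.hq).comp h.cont

lemma psi_continuous (hv : Continuous v) (n : ℕ) : Continuous (psi v n) :=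
  (cG_contDiff (eps n)).continuous.comp hv

lemma RectSol.energy_eq (h : RectSol p q κ s α v V1 V2) : EG p s α v = EH q s α v := by
  have hcpf := h.cpf
  have hcont := h.cont
  have hL : Tendsto (fun n => ∫ x in Rect s α, (V1 x * fderiv ℝ (psi v n) x (1, 0) +
      V2 x * fderiv ℝ (psi v n) x (0, 1))) atTop (𝓝 (EG p s α v)) := by
    unfold EG
    have e : ∀ n, ∫ x in Rect s α, (V1 x * fderiv ℝ (psi v n) x (1, 0) +
      V2 x * fderiv ℝ (psi v n) x (0, 1)) =
        ∫ x in Rect s α, ck (eps n) (v x) * ((1 + x.1) * ‖gw v x‖ ^ p) := by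
      intro n
      apply setIntegral_congr_fun (measurableSet_Rect s α)
      intro x hx
      simp only []
      rw [← h.pair_self hx, h.psi_fderiv n hx]
      simp
      ring
    simp_rw [e]
    apply tendsto_integral_of_dominated_convergence (fun x => (1 + x.1) * ‖gw v x‖ ^ p)
    · intro n
      exact ((ck_continuous _).comp hcont).aestronglyMeasurable.mul h.int.aestronglyMeasurable
    · exact h.int
    · intro n
      rw [ae_restrict_iff' (measurableSet_Rect s α)]
      refine Eventually.of_forall fun x hx => ?_
      have := h.one_add_pos hx
      have h0 : 0 ≤ (1 + x.1) * ‖gw v x‖ ^ p := by positivity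
      rw [norm_mul, Real.norm_of_nonneg h0, Real.norm_of_nonneg (ck_nonneg _ _)]
      exact mul_le_of_le_one_left h0 (ck_le_one _ _)
    · rw [ae_restrict_iff' (measurableSet_Rect s α)]
      filter_upwards [h.null] with x hx hxR
      by_cases hv : v x = 0
      · rw [hx hxR hv]
        simp [Real.zero_rpow (show p ≠ 0 by linarith [h.hp1])]
      · simpa using (ck_tendsto hv).mul_const ((1 + x.1) * ‖gw v x‖ ^ p)
  have hR : Tendsto (fun n => ∫ x in Rect s α, (1 + x.1) * pf q (v x) * psi v n x) atTop
      (𝓝 (EH q s α v)) := by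
    have e : EH q s α v = ∫ x in Rect s α, (1 + x.1) * pf q (v x) * v x := by
      unfold EH
      congr 1
      ext x
      rw [mul_assoc, pf_mul_self h.hq]
    rw [e]
    apply tendsto_integral_of_dominated_convergence (fun x => |(1 + x.1) * pf q (v x)| * |v x|)
    · intro n
      have := psi_continuous hcont n
      exact Continuous.aestronglyMeasurable (by fun_prop)
    · exact cont_int (by fun_prop) s α
    · intro n
      refine Eventually.of_forall fun x => ?_
      rw [norm_mul]
      exact mul_le_mul_of_nonneg_left (cG_abs_le _ _) (abs_nonneg _)
    · refine Eventually.of_forall fun x => ?_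
      exact (cG_tendsto (v x)).const_mul _
  refine tendsto_nhds_unique hL (hR.congr fun n => ?_)
  exact (h.test (h.psi_contDiff n) (h.psi_tsupport n)).2.symm

/-! ### Dilation -/

lemma smul_mem_Rect {l : ℝ} (hl : 1 ≤ l) {x : ℝ × ℝ} (hx : l • x ∈ Rect s α) : x ∈ Rect s α := by
  obtain ⟨⟨h1, h2⟩, h3, h4⟩ := hx
  simp only [Prod.smul_fst, Prod.smul_snd, smul_eq_mul] at h1 h2 h3 h4
  have key : ∀ a t : ℝ, -a < l * t → l * t < a → -a < t ∧ t < a := by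
    intro a t h1 h2
    have ha : 0 < a := by linarith
    constructor
    · by_contra hc
      push Not at hc
      nlinarith
    · by_contra hc
      push Not at hc
      nlinarith
  exact ⟨key _ _ h1 h2, key _ _ h3 h4⟩

/-- Dilated truncation. -/
def psil (v : ℝ × ℝ → ℝ) (n : ℕ) (l : ℝ) (x : ℝ × ℝ) : ℝ := psi v n (l • x)

lemma RectSol.psil_tsupport (h : RectSol p q κ s α v V1 V2) (n : ℕ) {l : ℝ} (hl : 1 ≤ l) :
    tsupport (psil v n l) ⊆ Rect s α := by
  intro x hx
  have := tsupport_comp_subset_preimage (psi v n) (f := fun x : ℝ × ℝ => l • x)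
    (continuous_const_smul l) hx
  exact smul_mem_Rect hl (h.psi_tsupport n this)

lemma RectSol.psil_contDiff (h : RectSol p q κ s α v V1 V2) (n : ℕ) (l : ℝ) :
    ContDiff ℝ 1 (psil v n l) :=
  (h.psi_contDiff n).comp (contDiff_const_smul l)

lemma RectSol.psil_fderiv (h : RectSol p q κ s α v V1 V2) (n : ℕ) (l : ℝ) (x : ℝ × ℝ) :
    fderiv ℝ (psil v n l) x = l • fderiv ℝ (psi v n) (l • x) := by
  have h1 : HasFDerivAt (psi v n) (fderiv ℝ (psi v n) (l • x)) (l • x) :=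
    ((h.psi_contDiff n).contDiffAt.differentiableAt (by simp)).hasFDerivAt
  have h2 : HasFDerivAt (fun x : ℝ × ℝ => l • x) (l • ContinuousLinearMap.id ℝ (ℝ × ℝ)) x :=
    (hasFDerivAt_id x).const_smul l
  have h3 := (h1.comp x h2).fderiv
  have : (psi v n ∘ fun x : ℝ × ℝ => l • x) = psil v n l := rfl
  rw [this] at h3
  rw [h3]
  ext <;> simp

/-- Weighted comparison: the weight at `x` versus at `l • x`. -/
lemma RectSol.weight (h : RectSol p q κ s α v V1 V2) {l : ℝ} (hl : 1 < l) {x : ℝ × ℝ}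
    (hx : l • x ∈ Rect s α) :
    (1 - κ * (1 - l⁻¹)) * (1 + (l • x).1) ≤ 1 + x.1 ∧
    1 + x.1 ≤ (1 + κ * (1 - l⁻¹)) * (1 + (l • x).1) := by
  have h1 := h.hκ (l • x).1 (abs_lt.2 hx.1)
  have h2 : x.1 = (l • x).1 - (l • x).1 * (1 - l⁻¹) := by
    simp only [Prod.smul_fst, smul_eq_mul]
    have : l ≠ 0 := by linarith
    field_simp
    ring
  have hm : 0 ≤ 1 - l⁻¹ := sub_nonneg.2 (inv_le_one_of_one_le₀ hl.le)
  obtain ⟨h3, h4⟩ := abs_le.1 h1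
  have h5 := mul_le_mul_of_nonneg_right h3 hm
  have h6 := mul_le_mul_of_nonneg_right h4 hm
  constructor <;> nlinarith

lemma RectSol.mu (h : RectSol p q κ s α v V1 V2) {l : ℝ} (hl : 1 < l) :
    0 ≤ 1 - l⁻¹ ∧ 0 < 1 - κ * (1 - l⁻¹) ∧ 1 - κ * (1 - l⁻¹) ≤ 1 := by
  have hm : 0 ≤ 1 - l⁻¹ := sub_nonneg.2 (inv_le_one_of_one_le₀ hl.le)
  have hm1 : 1 - l⁻¹ < 1 := by
    have : 0 < l⁻¹ := inv_pos.2 (by linarith)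
    linarith
  have h1 := h.hκ0
  have h2 := h.hκ1
  refine ⟨hm, ?_, ?_⟩ <;> nlinarith

lemma norm_mk_le {a b a' b' c : ℝ} (hc : 0 ≤ c) (ha : |a| ≤ c * |a'|) (hb : |b| ≤ c * |b'|) :
    ‖(⟨a, b⟩ : ℂ)‖ ≤ c * ‖(⟨a', b'⟩ : ℂ)‖ := by
  have h0 : 0 ≤ c * ‖(⟨a', b'⟩ : ℂ)‖ := by positivity
  refine (pow_le_pow_iff_left₀ (norm_nonneg _) h0 two_ne_zero).1 ?_
  rw [mul_pow, Complex.sq_norm, Complex.sq_norm, Complex.normSq_apply, Complex.normSq_apply]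
  have h1 := pow_le_pow_left₀ (abs_nonneg a) ha 2
  have h2 := pow_le_pow_left₀ (abs_nonneg b) hb 2
  rw [mul_pow, sq_abs, sq_abs] at h1 h2
  simp only
  nlinarith

/-- The dilation constant. -/
def DD (p κ l : ℝ) : ℝ := (1 + κ * (1 - l⁻¹)) * (l / (1 - κ * (1 - l⁻¹))) ^ p

/-- The extended energy density. -/
def KK (p s α : ℝ) (v : ℝ × ℝ → ℝ) : ℝ × ℝ → ℝ :=
  (Rect s α).indicator (fun x => (1 + x.1) * ‖gw v x‖ ^ p)

lemma RectSol.KK_nonneg (h : RectSol p q κ s α v V1 V2) (x : ℝ × ℝ) : 0 ≤ KK p s α v x := by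
  apply indicator_nonneg
  intro x hx
  have := h.one_add_pos hx
  positivity

lemma RectSol.gw_psil (h : RectSol p q κ s α v V1 V2) (n : ℕ) {l : ℝ} (hl : 1 < l)
    (x : ℝ × ℝ) : (1 + x.1) * ‖gw (psil v n l) x‖ ^ p ≤ DD p κ l * KK p s α v (l • x) := by
  have hp0 : p ≠ 0 := by linarith [h.hp1]
  by_cases hx : l • x ∈ Rect s α
  · obtain ⟨w1, w2⟩ := h.weight hl hx
    obtain ⟨m1, m2, m3⟩ := h.mu hl
    have hpos' := h.one_add_pos hx
    have hpos := h.one_add_pos (smul_mem_Rect hl.le hx)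
    set c := 1 - κ * (1 - l⁻¹) with hc
    have hl0 : 0 < l := by linarith
    have k0 := ck_nonneg (eps n) (v (l • x))
    have k1 := ck_le_one (eps n) (v (l • x))
    have hn : ‖gw (psil v n l) x‖ ≤ l / c * ‖gw v (l • x)‖ := by
      unfold gw
      rw [h.psil_fderiv, h.psi_fderiv n hx]
      apply norm_mk_le (by positivity)
      · simp only [smul_apply, smul_eq_mul, abs_mul, abs_of_pos hl0,
          abs_of_nonneg k0]
        rw [div_mul_eq_mul_div, mul_div_assoc]
        apply mul_le_mul_of_nonneg_left _ hl0.le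
        rw [le_div_iff₀ m2]
        have := abs_nonneg (fderiv ℝ v (l • x) (1, 0))
        have h1 : ck (eps n) (v (l • x)) * |fderiv ℝ v (l • x) (1, 0)| ≤
          |fderiv ℝ v (l • x) (1, 0)| := mul_le_of_le_one_left this k1
        refine le_trans (mul_le_of_le_one_right (by positivity) m3) h1
      · simp only [smul_apply, smul_eq_mul, abs_div, abs_mul, abs_of_pos hl0,
          abs_of_nonneg k0, abs_of_pos hpos, abs_of_pos hpos']
        have := abs_nonneg (fderiv ℝ v (l • x) (0, 1))
        rw [div_mul_div_comm]
        apply div_le_div₀ (by positivity) _ (by positivity) w1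
        apply mul_le_mul_of_nonneg_left _ hl0.le
        exact mul_le_of_le_one_left this k1
    have hn' := Real.rpow_le_rpow (norm_nonneg _) hn (show 0 ≤ p by linarith [h.hp1])
    rw [Real.mul_rpow (by positivity) (norm_nonneg _)] at hn'
    unfold DD KK
    rw [indicator_of_mem hx]
    calc _ ≤ ((1 + κ * (1 - l⁻¹)) * (1 + (l • x).1)) * ((l / c) ^ p * ‖gw v (l • x)‖ ^ p) := by
          apply mul_le_mul w2 hn' (by positivity)
          have := h.hκ0
          positivity
      _ = _ := by ring
  · have : gw (psil v n l) x = 0 := by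
      unfold gw
      rw [h.psil_fderiv, fderiv_zero_off (h.psi_tsupport n) hx]
      apply Complex.ext <;> simp
    rw [this, KK, indicator_of_notMem hx]
    simp [Real.zero_rpow hp0]

lemma RectSol.KK_int (h : RectSol p q κ s α v V1 V2) : Integrable (KK p s α v) :=
  h.int.integrable_indicator (measurableSet_Rect s α)

lemma int_smul (f : ℝ × ℝ → ℝ) {l : ℝ} (hl : 0 < l) :
    ∫ x, f (l • x) = (l ^ 2)⁻¹ * ∫ x, f x := by
  rw [Measure.integral_comp_smul]
  simp [abs_of_pos hl]

lemma RectSol.upper_n (h : RectSol p q κ s α v V1 V2) (n : ℕ) {l : ℝ} (hl : 1 < l) :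
    ∫ x in Rect s α, (1 + x.1) * pf q (v x) * psil v n l x ≤
      DD p κ l * ((l ^ 2)⁻¹ * EG p s α v) / p + (1 - 1 / p) * EG p s α v := by
  obtain ⟨t1, t2⟩ := h.test (h.psil_contDiff n l) (h.psil_tsupport n hl.le)
  have hp := h.hp1
  have hl0 : 0 < l := by linarith
  have iK : Integrable (fun x => KK p s α v (l • x)) := h.KK_int.comp_smul hl0.ne'
  have iA : Integrable (fun x => DD p κ l * KK p s α v (l • x) / p) :=
    (iK.const_mul _).div_const _
  have iB : IntegrableOn (fun x => (1 - 1 / p) * ((1 + x.1) * ‖gw v x‖ ^ p)) (Rect s α) :=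
    h.int.const_mul _
  obtain ⟨m1, m2, m3⟩ := h.mu hl
  have hD : 0 ≤ DD p κ l := by
    unfold DD
    have := h.hκ0
    positivity
  rw [← t2]
  calc _ ≤ ∫ x in Rect s α, (DD p κ l * KK p s α v (l • x) / p +
        (1 - 1 / p) * ((1 + x.1) * ‖gw v x‖ ^ p)) := by
        apply setIntegral_mono_on t1 (iA.integrableOn.add iB) (measurableSet_Rect s α)
        intro x hx
        refine (h.pair_le hx _).trans ?_
        have := div_le_div_of_nonneg_right (h.gw_psil n hl x) (show 0 ≤ p by linarith)
        simp only [Pi.add_apply]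
        linarith
    _ = (∫ x in Rect s α, DD p κ l * KK p s α v (l • x) / p) +
        ∫ x in Rect s α, (1 - 1 / p) * ((1 + x.1) * ‖gw v x‖ ^ p) :=
        integral_add iA.integrableOn iB
    _ ≤ (∫ x, DD p κ l * KK p s α v (l • x) / p) +
        ∫ x in Rect s α, (1 - 1 / p) * ((1 + x.1) * ‖gw v x‖ ^ p) := by
        refine add_le_add (setIntegral_le_integral iA (Eventually.of_forall fun x => ?_)) le_rfl
        have := h.KK_nonneg (l • x)
        simp only [Pi.zero_apply]
        positivity
    _ = _ := by
        rw [integral_div, integral_const_mul, integral_const_mul, int_smul _ hl0]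
        have e : ∫ x, KK p s α v x = EG p s α v := by
          unfold KK
          rw [integral_indicator (measurableSet_Rect s α)]
          rfl
        rw [e]
        rfl

lemma RectSol.upper (h : RectSol p q κ s α v V1 V2) {l : ℝ} (hl : 1 < l) :
    ∫ x in Rect s α, (1 + x.1) * pf q (v x) * v (l • x) ≤
      DD p κ l * ((l ^ 2)⁻¹ * EG p s α v) / p + (1 - 1 / p) * EG p s α v := by
  refine le_of_tendsto (f := fun n => ∫ x in Rect s α, (1 + x.1) * pf q (v x) * psil v n l x)
    (x := atTop) ?_ (Eventually.of_forall fun n => h.upper_n n hl)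
  have hcpf := h.cpf
  have hcont := h.cont
  apply tendsto_integral_of_dominated_convergence
    (fun x => |(1 + x.1) * pf q (v x)| * |v (l • x)|)
  · intro n
    have := (h.psil_contDiff n l).continuous
    exact Continuous.aestronglyMeasurable (by fun_prop)
  · exact cont_int (by fun_prop) s α
  · intro n
    refine Eventually.of_forall fun x => ?_
    rw [norm_mul]
    exact mul_le_mul_of_nonneg_left (cG_abs_le _ _) (abs_nonneg _)
  · refine Eventually.of_forall fun x => ?_
    exact (cG_tendsto (v (l • x))).const_mul _

end

section
variable {p q κ s α : ℝ} {v V1 V2 : ℝ × ℝ → ℝ}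

lemma norm_fderiv_le_gw (φ : ℝ × ℝ → ℝ) {x : ℝ × ℝ} (h0 : 0 < 1 + x.1) (h2 : 1 + x.1 < 2) :
    ‖fderiv ℝ φ x‖ ≤ 3 * ‖gw φ x‖ := by
  refine ContinuousLinearMap.opNorm_le_bound _ (by positivity) ?_
  intro y
  have e : y = y.1 • ((1, 0) : ℝ × ℝ) + y.2 • ((0, 1) : ℝ × ℝ) := by ext <;> simp
  have h1 : fderiv ℝ φ x y = y.1 * (gw φ x).re + y.2 * ((1 + x.1) * (gw φ x).im) := by
    conv_lhs => rw [e]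
    rw [map_add, map_smul, map_smul]
    simp only [gw, smul_eq_mul]
    field_simp
  rw [h1]
  have a1 := Complex.abs_re_le_norm (gw φ x)
  have a2 := Complex.abs_im_le_norm (gw φ x)
  have b1 : |y.1| ≤ ‖y‖ := norm_fst_le y
  have b2 : |y.2| ≤ ‖y‖ := norm_snd_le y
  rw [Real.norm_eq_abs]
  refine (abs_add_le _ _).trans ?_
  rw [abs_mul, abs_mul, abs_mul, abs_of_pos h0]
  have c1 : |y.1| * |(gw φ x).re| ≤ ‖y‖ * ‖gw φ x‖ :=
    mul_le_mul b1 a1 (abs_nonneg _) (norm_nonneg _)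
  have c2 : |y.2| * ((1 + x.1) * |(gw φ x).im|) ≤ ‖y‖ * (2 * ‖gw φ x‖) :=
    mul_le_mul b2 (mul_le_mul h2.le a2 (abs_nonneg _) (by norm_num)) (by positivity)
      (norm_nonneg _)
  linarith

lemma RectSol.fderiv_int (h : RectSol p q κ s α v V1 V2) :
    IntegrableOn (fun x => ‖fderiv ℝ v x‖) (Rect s α) := by
  have hd := h.cd.continuousOn_fderiv_of_isOpen (isOpen_Rect s α) le_rfl
  have hs : 0 < 1 - s := by linarith [h.hs1]
  have i1 : IntegrableOn (fun x : ℝ × ℝ => 3 * (1 + (1 - s)⁻¹ * ((1 + x.1) * ‖gw v x‖ ^ p)))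
      (Rect s α) :=
    ((cont_int continuous_const s α).add (h.int.const_mul _)).const_mul _
  refine Integrable.mono' i1 (hd.norm.aestronglyMeasurable (measurableSet_Rect s α)) ?_
  rw [ae_restrict_iff' (measurableSet_Rect s α)]
  refine Eventually.of_forall fun x hx => ?_
  rw [norm_norm]
  refine (norm_fderiv_le_gw v (h.one_add_pos hx) (h.one_add_lt hx)).trans ?_
  apply mul_le_mul_of_nonneg_left _ (by norm_num : (0:ℝ) ≤ 3)
  have hg : 0 ≤ ‖gw v x‖ := norm_nonneg _
  have h1 : ‖gw v x‖ ^ p ≤ (1 - s)⁻¹ * ((1 + x.1) * ‖gw v x‖ ^ p) := by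
    rw [inv_mul_eq_div, le_div_iff₀ hs, mul_comm]
    apply mul_le_mul_of_nonneg_right _ (by positivity)
    have := hx.1.1
    linarith
  rcases le_total ‖gw v x‖ 1 with hle | hle
  · have : 0 ≤ ‖gw v x‖ ^ p := by positivity
    linarith
  · have : ‖gw v x‖ ^ (1:ℝ) ≤ ‖gw v x‖ ^ p := Real.rpow_le_rpow_of_exponent_le hle h.hp1.le
    rw [Real.rpow_one] at this
    linarith

lemma RectSol.psi_L1 (h : RectSol p q κ s α v V1 V2) (n : ℕ) :
    ∫ x, ‖fderiv ℝ (psi v n) x‖ ≤ ∫ x in Rect s α, ‖fderiv ℝ v x‖ := by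
  have e : ∫ x in Rect s α, ‖fderiv ℝ (psi v n) x‖ = ∫ x, ‖fderiv ℝ (psi v n) x‖ := by
    apply setIntegral_eq_integral_of_forall_compl_eq_zero
    intro x hx
    simp [fderiv_zero_off (h.psi_tsupport n) hx]
  rw [← e]
  have hc : Continuous (fun x => ‖fderiv ℝ (psi v n) x‖) :=
    ((h.psi_contDiff n).continuous_fderiv (by simp)).norm
  apply setIntegral_mono_on (cont_int hc s α) h.fderiv_int (measurableSet_Rect s α)
  intro x hx
  rw [h.psi_fderiv n hx, norm_smul, Real.norm_of_nonneg (ck_nonneg _ _)]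
  exact mul_le_of_le_one_left (norm_nonneg _) (ck_le_one _ _)

lemma RectSol.diff_L1_n (h : RectSol p q κ s α v V1 V2) {M : ℝ} (hM0 : 0 ≤ M)
    (hM : ∀ x ∈ Rect s α, ‖x‖ ≤ M) (n : ℕ) {l : ℝ} (hl : 1 < l) :
    ∫ x in Rect s α, |psi v n (l • x) - psi v n x| ≤
      (l - 1) * (M * ∫ x in Rect s α, ‖fderiv ℝ v x‖) := by
  have hψ := h.psi_contDiff n
  have hψc := hψ.continuous
  have hdc : Continuous (fderiv ℝ (psi v n)) := hψ.continuous_fderiv (by simp)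
  have hF : Continuous (fun z : (ℝ × ℝ) × ℝ => ‖fderiv ℝ (psi v n) (z.2 • z.1)‖) := by fun_prop
  have hJint : Integrable (Function.uncurry fun (x : ℝ × ℝ) (t : ℝ) =>
      ‖fderiv ℝ (psi v n) (t • x)‖)
      ((volume.restrict (Rect s α)).prod (volume.restrict (Ioc 1 l))) := by
    rw [Measure.prod_restrict]
    have hb : Bornology.IsBounded (Rect s α ×ˢ Ioc 1 l) :=
      (isBounded_Rect s α).prod (Metric.isBounded_Ioc _ _)
    exact (hF.continuousOn.integrableOn_compact
      (Metric.isCompact_of_isClosed_isBounded isClosed_closure hb.closure)).mono_set subset_closure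
  have pw : ∀ x ∈ Rect s α, |psi v n (l • x) - psi v n x| ≤
      M * ∫ t in Ioc 1 l, ‖fderiv ℝ (psi v n) (t • x)‖ := by
    intro x hx
    have hder : ∀ t ∈ uIcc 1 l, HasDerivAt (fun t : ℝ => psi v n (t • x))
        (fderiv ℝ (psi v n) (t • x) x) t := by
      intro t _
      have h1 : HasFDerivAt (psi v n) (fderiv ℝ (psi v n) (t • x)) (t • x) :=
        (hψ.contDiffAt.differentiableAt (by simp)).hasFDerivAt
      have h2 : HasDerivAt (fun τ : ℝ => τ • x) x t := by
        simpa using (hasDerivAt_id t).smul_const x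
      exact h1.comp_hasDerivAt t h2
    have hcx : Continuous (fun t : ℝ => fderiv ℝ (psi v n) (t • x) x) := by fun_prop
    have hcn : Continuous (fun t : ℝ => ‖fderiv ℝ (psi v n) (t • x)‖) := by fun_prop
    have := intervalIntegral.integral_eq_sub_of_hasDerivAt hder (hcx.intervalIntegrable 1 l)
    simp only [one_smul] at this
    rw [← this, intervalIntegral.integral_of_le hl.le, ← integral_const_mul]
    rw [← Real.norm_eq_abs]
    apply norm_integral_le_of_norm_le
    · exact (hcn.const_mul M).integrableOn_Ioc
    · refine Eventually.of_forall fun t => ?_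
      refine (ContinuousLinearMap.le_opNorm _ _).trans ?_
      rw [mul_comm]
      exact mul_le_mul_of_nonneg_right (hM x hx) (norm_nonneg _)
  have inner : ∀ t ∈ Ioc 1 l, ∫ x in Rect s α, ‖fderiv ℝ (psi v n) (t • x)‖ ≤
      ∫ x in Rect s α, ‖fderiv ℝ v x‖ := by
    intro t ht
    have ht0 : 0 < t := by linarith [ht.1]
    refine le_trans ?_ (h.psi_L1 n)
    have hi : Integrable (fun x => ‖fderiv ℝ (psi v n) x‖) :=
      hdc.norm.integrable_of_hasCompactSupport
        (((hcs_of_tsupport (h.psi_tsupport n)).fderiv ℝ).norm)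
    have hi2 : Integrable (fun x => ‖fderiv ℝ (psi v n) (t • x)‖) := hi.comp_smul ht0.ne'
    refine (setIntegral_le_integral hi2 (Eventually.of_forall fun x => norm_nonneg _)).trans ?_
    rw [int_smul (fun x => ‖fderiv ℝ (psi v n) x‖) ht0]
    apply mul_le_of_le_one_left (integral_nonneg fun x => norm_nonneg _)
    exact inv_le_one_of_one_le₀ (one_le_pow₀ ht.1.le)
  calc _ ≤ ∫ x in Rect s α, M * ∫ t in Ioc 1 l, ‖fderiv ℝ (psi v n) (t • x)‖ := by
        apply setIntegral_mono_on (cont_int (by fun_prop) s α) (hJint.integral_prod_left.const_mul M)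
          (measurableSet_Rect s α)
        exact pw
    _ = M * ∫ t in Ioc 1 l, ∫ x in Rect s α, ‖fderiv ℝ (psi v n) (t • x)‖ := by
        rw [integral_const_mul, integral_integral_swap hJint]
    _ ≤ M * ∫ t in Ioc 1 l, ∫ x in Rect s α, ‖fderiv ℝ v x‖ := by
        apply mul_le_mul_of_nonneg_left _ hM0
        apply setIntegral_mono_on hJint.integral_prod_right
          continuous_const.integrableOn_Ioc measurableSet_Ioc
        exact inner
    _ = _ := by
        simp [hl.le]
        ring

lemma RectSol.diff_L1 (h : RectSol p q κ s α v V1 V2) {M : ℝ} (hM0 : 0 ≤ M)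
    (hM : ∀ x ∈ Rect s α, ‖x‖ ≤ M) {l : ℝ} (hl : 1 < l) :
    ∫ x in Rect s α, |v (l • x) - v x| ≤
      (l - 1) * (M * ∫ x in Rect s α, ‖fderiv ℝ v x‖) := by
  refine le_of_tendsto (f := fun n => ∫ x in Rect s α, |psi v n (l • x) - psi v n x|)
    (x := atTop) ?_ (Eventually.of_forall fun n => h.diff_L1_n hM0 hM n hl)
  have hcont := h.cont
  apply tendsto_integral_of_dominated_convergence (fun x => |v (l • x)| + |v x|)
  · intro n
    have := psi_continuous hcont n
    exact Continuous.aestronglyMeasurable (by fun_prop)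
  · exact cont_int (by fun_prop) s α
  · intro n
    refine Eventually.of_forall fun x => ?_
    rw [Real.norm_eq_abs, abs_abs]
    exact (abs_sub _ _).trans (add_le_add (cG_abs_le _ _) (cG_abs_le _ _))
  · refine Eventually.of_forall fun x => ?_
    exact ((cG_tendsto (v (l • x))).sub (cG_tendsto (v x))).abs

lemma RectSol.lower (h : RectSol p q κ s α v V1 V2) {η : ℝ} {l : ℝ} (hl : 1 < l)
    (hη : ∀ x ∈ Rect s α, |pf q (v (l • x)) - pf q (v x)| ≤ η) :
    EH q s α v + ((l ^ 2)⁻¹ * ((1 - κ * (1 - l⁻¹)) * EH q s α v) / q - EH q s α v / q) -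
      2 * η * (∫ x in Rect s α, |v (l • x) - v x|) ≤
    ∫ x in Rect s α, (1 + x.1) * pf q (v x) * v (l • x) := by
  have hl0 : 0 < l := by linarith
  have hcont := h.cont
  have hcpf := h.cpf
  have hq0 : 0 < q := by linarith [h.hq]
  have hcq : Continuous (fun x => |v x| ^ q) :=
    hcont.abs.rpow_const (fun x => Or.inr hq0.le)
  have hcql : Continuous (fun x => |v (l • x)| ^ q) :=
    hcq.comp (continuous_const_smul l)
  have i1 : IntegrableOn (fun x : ℝ × ℝ => (1 + x.1) * |v x| ^ q) (Rect s α) :=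
    cont_int (by fun_prop) s α
  have i2 : IntegrableOn (fun x : ℝ × ℝ => (1 + x.1) * |v (l • x)| ^ q) (Rect s α) :=
    cont_int (by fun_prop) s α
  have i3 : IntegrableOn (fun x : ℝ × ℝ => |v (l • x) - v x|) (Rect s α) :=
    cont_int (by fun_prop) s α
  have i4 : IntegrableOn (fun x : ℝ × ℝ => (1 + x.1) * pf q (v x) * v (l • x)) (Rect s α) :=
    cont_int (by fun_prop) s α
  have step1 : (l ^ 2)⁻¹ * ((1 - κ * (1 - l⁻¹)) * EH q s α v) ≤
      ∫ x in Rect s α, (1 + x.1) * |v (l • x)| ^ q := by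
    set J : ℝ × ℝ → ℝ := (Rect s α).indicator (fun x => (1 + x.1) * |v x| ^ q) with hJ
    have eJ : ∫ x, J x = EH q s α v := by
      rw [hJ, integral_indicator (measurableSet_Rect s α)]; rfl
    have iJ : Integrable J := i1.integrable_indicator (measurableSet_Rect s α)
    have iJl : Integrable (fun x => J (l • x)) := iJ.comp_smul hl0.ne'
    have e2 : ∫ x in Rect s α, J (l • x) = ∫ x, J (l • x) := by
      apply setIntegral_eq_integral_of_forall_compl_eq_zero
      intro x hx
      rw [hJ, indicator_of_notMem (fun h' => hx (smul_mem_Rect hl.le h'))]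
    have e3 : (l ^ 2)⁻¹ * ((1 - κ * (1 - l⁻¹)) * EH q s α v) =
        ∫ x in Rect s α, (1 - κ * (1 - l⁻¹)) * J (l • x) := by
      rw [integral_const_mul, e2, int_smul J hl0, eJ]; ring
    rw [e3]
    apply setIntegral_mono_on (iJl.integrableOn.const_mul _) i2 (measurableSet_Rect s α)
    intro x hx
    by_cases hx' : l • x ∈ Rect s α
    · rw [hJ, indicator_of_mem hx', ← mul_assoc]
      exact mul_le_mul_of_nonneg_right (h.weight hl hx').1 (by positivity)
    · rw [hJ, indicator_of_notMem hx', mul_zero]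
      have := h.one_add_pos hx
      positivity
  have step2 : ∫ x in Rect s α, (((1 + x.1) * |v x| ^ q + ((1 + x.1) * |v (l • x)| ^ q / q -
      (1 + x.1) * |v x| ^ q / q)) - 2 * η * |v (l • x) - v x|) ≤
      ∫ x in Rect s α, (1 + x.1) * pf q (v x) * v (l • x) := by
    apply setIntegral_mono_on ((i1.add ((i2.div_const q).sub (i1.div_const q))).sub
      (i3.const_mul _)) i4 (measurableSet_Rect s α)
    intro x hx
    simp only [Pi.add_apply, Pi.sub_apply]
    have hpos := h.one_add_pos hx
    have hlt := h.one_add_lt hx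
    have c1 := mul_le_mul_of_nonneg_left (pf_convex h.hq (v x) (v (l • x))) hpos.le
    have c2 := pf_mul_self h.hq (v x)
    have c3 : (1 + x.1) * (|pf q (v (l • x)) - pf q (v x)| * |v (l • x) - v x|) ≤
        2 * (η * |v (l • x) - v x|) :=
      mul_le_mul hlt.le (mul_le_mul_of_nonneg_right (hη x hx) (abs_nonneg _)) (by positivity)
        (by norm_num)
    rw [← c2] at c1 ⊢
    have e1 : (1 + x.1) * |v (l • x)| ^ q / q = (1 + x.1) * (|v (l • x)| ^ q / q) := by ring
    have e2 : (1 + x.1) * (pf q (v x) * v x) / q = (1 + x.1) * ((pf q (v x) * v x) / q) := by ring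
    rw [e1, e2]
    nlinarith
  have i5 : IntegrableOn (fun x : ℝ × ℝ => (1 + x.1) * |v (l • x)| ^ q / q -
      (1 + x.1) * |v x| ^ q / q) (Rect s α) := (i2.div_const q).sub (i1.div_const q)
  have i6 : IntegrableOn (fun x : ℝ × ℝ => (1 + x.1) * |v x| ^ q + ((1 + x.1) * |v (l • x)| ^ q / q -
      (1 + x.1) * |v x| ^ q / q)) (Rect s α) := i1.add i5
  rw [integral_sub i6 (i3.const_mul _), integral_add i1 i5, integral_sub (i2.div_const q) (i1.div_const q), integral_div, integral_div,
    integral_const_mul] at step2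
  refine le_trans ?_ step2
  have := div_le_div_of_nonneg_right step1 hq0.le
  unfold EH at *
  linarith

end

section
variable {p q κ s α : ℝ} {v V1 V2 : ℝ × ℝ → ℝ}

/-- The one variable function governing the dilation inequality. -/
def Phi (p q κ l : ℝ) : ℝ :=
  (DD p κ l * (l ^ 2)⁻¹ - 1) / p - ((l ^ 2)⁻¹ * (1 - κ * (1 - l⁻¹)) - 1) / q

lemma Phi_one (p q κ : ℝ) : Phi p q κ 1 = 0 := by simp [Phi, DD]

lemma Phi_deriv (p q κ : ℝ) :
    HasDerivAt (Phi p q κ) ((κ + p * (1 + κ) - 2) / p + (2 + κ) / q) 1 := by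
  have hinv : HasDerivAt (fun l : ℝ => l⁻¹) (-1) 1 := by
    simpa using hasDerivAt_inv (one_ne_zero : (1:ℝ) ≠ 0)
  have hmu : HasDerivAt (fun l : ℝ => κ * (1 - l⁻¹)) κ 1 := by
    simpa using (hinv.const_sub 1).const_mul κ
  have ha : HasDerivAt (fun l : ℝ => 1 + κ * (1 - l⁻¹)) κ 1 := hmu.const_add 1
  have hb : HasDerivAt (fun l : ℝ => 1 - κ * (1 - l⁻¹)) (-κ) 1 := hmu.const_sub 1
  have hd : HasDerivAt (fun l : ℝ => l / (1 - κ * (1 - l⁻¹))) (1 + κ) 1 := by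
    refine HasDerivAt.congr_deriv ((hasDerivAt_id (1:ℝ)).div hb (by simp)) ?_
    simp
  have he : HasDerivAt (fun l : ℝ => (l / (1 - κ * (1 - l⁻¹))) ^ p) (p * (1 + κ)) 1 := by
    refine HasDerivAt.congr_deriv (hd.rpow_const (p := p) (Or.inl (by simp))) ?_
    simp
    ring
  have hsq : HasDerivAt (fun l : ℝ => (l ^ 2)⁻¹) (-2) 1 := by
    refine HasDerivAt.congr_deriv ((hasDerivAt_pow 2 (1:ℝ)).inv (by simp)) ?_
    simp
  have hD : HasDerivAt (DD p κ) (κ + p * (1 + κ)) 1 := by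
    refine HasDerivAt.congr_deriv (ha.mul he) ?_
    simp
  have h1 : HasDerivAt (fun l => DD p κ l * (l ^ 2)⁻¹) (κ + p * (1 + κ) - 2) 1 := by
    refine HasDerivAt.congr_deriv (hD.mul hsq) ?_
    simp [DD]
    ring
  have h2 : HasDerivAt (fun l : ℝ => (l ^ 2)⁻¹ * (1 - κ * (1 - l⁻¹))) (-(2 + κ)) 1 := by
    refine HasDerivAt.congr_deriv (hsq.mul hb) ?_
    simp
    ring
  refine HasDerivAt.congr_deriv (((h1.sub_const 1).div_const p).sub ((h2.sub_const 1).div_const q)) ?_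
  ring

lemma RectSol.eventually_unif (h : RectSol p q κ s α v V1 V2) {M : ℝ} (hM0 : 0 ≤ M)
    (hM : ∀ x ∈ Rect s α, ‖x‖ ≤ M) {η : ℝ} (hη : 0 < η) :
    ∀ᶠ l : ℝ in 𝓝[>] 1, ∀ x ∈ Rect s α, |pf q (v (l • x)) - pf q (v x)| ≤ η := by
  have hcs : HasCompactSupport (fun x => pf q (v x)) := by
    refine HasCompactSupport.intro (K := closure (Rect s α))
      (Metric.isCompact_of_isClosed_isBounded isClosed_closure (isBounded_Rect s α).closure) ?_
    intro x hx
    rw [h.zero x (fun h' => hx (subset_closure h')), pf_zero]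
  have huc : UniformContinuous (fun x => pf q (v x)) :=
    hcs.uniformContinuous_of_continuous h.cpf
  obtain ⟨δ, hδ, hd⟩ := Metric.uniformContinuous_iff.1 huc η hη
  have hpos : 0 < δ / (M + 1) := by positivity
  filter_upwards [Ioo_mem_nhdsGT (show (1:ℝ) < 1 + δ / (M + 1) by linarith)] with l hl x hx
  have h1 : dist (l • x) x < δ := by
    rw [dist_eq_norm]
    have : l • x - x = (l - 1) • x := by rw [sub_smul, one_smul]
    rw [this, norm_smul, Real.norm_of_nonneg (by linarith [hl.1])]
    have h2 : l - 1 < δ / (M + 1) := by linarith [hl.2]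
    rw [lt_div_iff₀ (by positivity)] at h2
    have h3 : (l - 1) * ‖x‖ ≤ (l - 1) * (M + 1) :=
      mul_le_mul_of_nonneg_left (by linarith [hM x hx]) (by linarith [hl.1])
    linarith
  exact (hd h1).le

theorem RectSol.conclusion (h : RectSol p q κ s α v V1 V2)
    (hc : (κ + p * (1 + κ) - 2) / p + (2 + κ) / q < 0) : ∀ x ∈ Rect s α, v x = 0 := by
  obtain ⟨M', hM'⟩ := (isBounded_Rect s α).exists_norm_le
  obtain ⟨M, hM0, hM⟩ : ∃ M : ℝ, 0 ≤ M ∧ ∀ x ∈ Rect s α, ‖x‖ ≤ M :=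
    ⟨max M' 0, le_max_right _ _, fun x hx => (hM' x hx).trans (le_max_left _ _)⟩
  set L := ∫ x in Rect s α, ‖fderiv ℝ v x‖ with hL
  have hL0 : 0 ≤ L := integral_nonneg fun x => norm_nonneg _
  set d := (κ + p * (1 + κ) - 2) / p + (2 + κ) / q with hd
  have hE := h.energy_eq
  set E := EH q s α v with hEdef
  have key : ∀ η > 0, 0 ≤ d * E + 2 * η * (M * L) := by
    intro η hη
    have hs := (hasDerivAt_iff_tendsto_slope.1 (Phi_deriv p q κ)).mono_left
      (nhdsWithin_mono 1 (fun z hz => (ne_of_gt hz : z ≠ 1)) : 𝓝[>] (1:ℝ) ≤ 𝓝[≠] 1)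
    have hs2 := (hs.mul_const E).add_const (2 * η * (M * L))
    refine ge_of_tendsto hs2 ?_
    filter_upwards [h.eventually_unif hM0 hM hη, self_mem_nhdsWithin] with l hl1 hl
    have hl : 1 < l := hl
    have u1 := h.upper hl
    have u2 := h.lower hl hl1
    have u3 := h.diff_L1 hM0 hM hl
    rw [hE] at u1
    have u4 := mul_le_mul_of_nonneg_left u3 (show 0 ≤ 2 * η by linarith)
    have hpos : 0 < l - 1 := by linarith
    have u5 : 0 ≤ Phi p q κ l * E + 2 * η * ((l - 1) * (M * L)) := by
      unfold Phi
      have e1 : ((DD p κ l * (l ^ 2)⁻¹ - 1) / p - ((l ^ 2)⁻¹ * (1 - κ * (1 - l⁻¹)) - 1) / q) * E =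
        (DD p κ l * ((l ^ 2)⁻¹ * E) / p + (1 - 1 / p) * E) -
        (E + ((l ^ 2)⁻¹ * ((1 - κ * (1 - l⁻¹)) * E) / q - E / q)) := by ring
      rw [e1]
      linarith
    rw [slope_def_field, Phi_one, sub_zero]
    have e2 : Phi p q κ l / (l - 1) * E + 2 * η * (M * L) =
        (Phi p q κ l * E + 2 * η * ((l - 1) * (M * L))) / (l - 1) := by
      field_simp
    rw [e2]
    exact div_nonneg u5 hpos.le
  have hdE : 0 ≤ d * E := by
    have ht : Tendsto (fun η : ℝ => d * E + 2 * η * (M * L)) (𝓝[>] 0) (𝓝 (d * E)) := by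
      have : Continuous (fun η : ℝ => d * E + 2 * η * (M * L)) := by fun_prop
      have := this.tendsto 0
      simp only [mul_zero, zero_mul, add_zero] at this
      exact this.mono_left nhdsWithin_le_nhds
    refine ge_of_tendsto ht ?_
    filter_upwards [self_mem_nhdsWithin] with η hη
    exact key η hη
  have hq0 : 0 < q := by linarith [h.hq]
  have hE1 : E ≤ 0 := by
    by_contra hcon
    push Not at hcon
    nlinarith
  have hnn : ∀ x ∈ Rect s α, 0 ≤ (1 + x.1) * |v x| ^ q := by
    intro x hx
    have := h.one_add_pos hx
    positivity
  have hE0 : E = 0 :=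
    le_antisymm hE1 (setIntegral_nonneg (measurableSet_Rect s α) hnn)
  have hcq : Continuous (fun x : ℝ × ℝ => (1 + x.1) * |v x| ^ q) := by
    have := h.cont.abs.rpow_const (p := q) (fun x => Or.inr hq0.le)
    fun_prop
  have hz := (setIntegral_eq_zero_iff_of_nonneg_ae
    ((ae_restrict_iff' (measurableSet_Rect s α)).2 (Eventually.of_forall hnn))
    (cont_int hcq s α)).1 hE0
  have hz2 := Measure.eqOn_open_of_ae_eq hz (isOpen_Rect s α) hcq.continuousOn continuousOn_const
  intro x hx
  have h3 := hz2 hx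
  have h4 := h.one_add_pos hx
  simp only [Pi.zero_apply, mul_eq_zero, h4.ne', false_or] at h3
  rw [Real.rpow_eq_zero (abs_nonneg _) hq0.ne'] at h3
  exact abs_eq_zero.1 h3

end

/-! ### Transfer to polar coordinates -/

/-- Polar coordinates centered at radius `1`. -/
def PP (x : ℝ × ℝ) : ℂ :=
  ((1 + x.1) * Real.cos x.2) • (1 : ℂ) + ((1 + x.1) * Real.sin x.2) • Complex.I

lemma PP_re (x : ℝ × ℝ) : (PP x).re = (1 + x.1) * Real.cos x.2 := by
  simp only [PP, Complex.add_re, Complex.smul_re, Complex.one_re, Complex.I_re, smul_eq_mul]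
  ring

lemma PP_im (x : ℝ × ℝ) : (PP x).im = (1 + x.1) * Real.sin x.2 := by
  simp only [PP, Complex.add_im, Complex.smul_im, Complex.one_im, Complex.I_im, smul_eq_mul]
  ring

lemma PP_eq_polar (x : ℝ × ℝ) : PP x = Complex.polarCoord.symm (1 + x.1, x.2) := by
  rw [Complex.polarCoord_symm_apply]
  apply Complex.ext
  · rw [PP_re]; simp [-Complex.ofReal_cos, -Complex.ofReal_sin, -Complex.ofReal_add]
  · rw [PP_im]; simp [-Complex.ofReal_cos, -Complex.ofReal_sin, -Complex.ofReal_add]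

lemma PP_eq_exp (ρ θ : ℝ) : PP (ρ - 1, θ) = (ρ : ℂ) * Complex.exp (θ * Complex.I) := by
  apply Complex.ext
  · rw [PP_re, Complex.re_ofReal_mul, Complex.exp_ofReal_mul_I_re]; simp
  · rw [PP_im, Complex.im_ofReal_mul, Complex.exp_ofReal_mul_I_im]; simp

lemma PP_continuous : Continuous PP := by unfold PP; fun_prop

lemma PP_contDiff : ContDiff ℝ 1 PP := by unfold PP; fun_prop

lemma PP_hasFDerivAt (x : ℝ × ℝ) : ∃ L : ℝ × ℝ →L[ℝ] ℂ, HasFDerivAt PP L x ∧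
    L (1, 0) = Real.cos x.2 • (1 : ℂ) + Real.sin x.2 • Complex.I ∧
    L (0, 1) = (-((1 + x.1) * Real.sin x.2)) • (1 : ℂ) +
      ((1 + x.1) * Real.cos x.2) • Complex.I := by
  have h1 : HasFDerivAt (fun y : ℝ × ℝ => 1 + y.1) (ContinuousLinearMap.fst ℝ ℝ ℝ) x :=
    hasFDerivAt_fst.const_add 1
  have hc : HasFDerivAt (fun y : ℝ × ℝ => Real.cos y.2)
      ((-Real.sin x.2) • ContinuousLinearMap.snd ℝ ℝ ℝ) x := hasFDerivAt_snd.cos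
  have hs : HasFDerivAt (fun y : ℝ × ℝ => Real.sin y.2)
      (Real.cos x.2 • ContinuousLinearMap.snd ℝ ℝ ℝ) x := hasFDerivAt_snd.sin
  refine ⟨_, ((h1.mul hc).smul_const (1:ℂ)).add ((h1.mul hs).smul_const Complex.I), ?_, ?_⟩
  · simp
  · simp

lemma Omega2_eq (α s : ℝ) : Omega2 α s = PP '' Rect s α := by
  ext z
  constructor
  · rintro ⟨ρ, θ, h1, h2, rfl⟩
    refine ⟨(ρ - 1, θ), ⟨?_, ?_⟩, PP_eq_exp ρ θ⟩
    · exact abs_lt.1 h2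
    · exact abs_lt.1 h1
  · rintro ⟨⟨r, θ⟩, ⟨h1, h2⟩, rfl⟩
    refine ⟨1 + r, θ, abs_lt.2 h2, ?_, ?_⟩
    · rw [add_sub_cancel_left]; exact abs_lt.2 h1
    · rw [← PP_eq_exp]; simp

lemma PP_injOn : InjOn PP (Ioi (-1) ×ˢ Ioo (-π) π) := by
  rintro ⟨a, b⟩ ⟨h1, h2⟩ ⟨c, d⟩ ⟨h3, h4⟩ h
  rw [PP_eq_polar, PP_eq_polar] at h
  simp only [mem_Ioi] at h1 h3
  have := Complex.polarCoord.symm.injOn (x₁ := (1 + a, b)) (x₂ := (1 + c, d))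
    ⟨show 0 < 1 + a by linarith, h2⟩ ⟨show 0 < 1 + c by linarith, h4⟩ h
  simpa using this

lemma isOpen_Omega2 {α s : ℝ} (hα : α < π) (hs : s < 1) : IsOpen (Omega2 α s) := by
  have : Omega2 α s = Complex.polarCoord.symm '' (Ioo (1 - s) (1 + s) ×ˢ Ioo (-α) α) := by
    rw [Omega2_eq]
    ext z
    constructor
    · rintro ⟨⟨r, θ⟩, ⟨h1, h2⟩, rfl⟩
      refine ⟨(1 + r, θ), ⟨?_, h2⟩, (PP_eq_polar (r, θ)).symm⟩
      simp only [mem_Ioo] at h1 ⊢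
      constructor <;> linarith [h1.1, h1.2]
    · rintro ⟨⟨r, θ⟩, ⟨h1, h2⟩, rfl⟩
      refine ⟨(r - 1, θ), ⟨?_, h2⟩, ?_⟩
      · simp only [mem_Ioo] at h1 ⊢
        constructor <;> linarith [h1.1, h1.2]
      · rw [PP_eq_polar]; simp
  rw [this]
  apply Complex.polarCoord.isOpen_image_symm_of_subset_target (isOpen_Ioo.prod isOpen_Ioo)
  rintro ⟨r, θ⟩ ⟨h1, h2⟩
  simp only [mem_Ioo] at h1 h2
  exact ⟨show 0 < r by linarith [h1.1], show -π < θ by linarith [h2.1],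
    show θ < π by linarith [h2.2]⟩

lemma closure_Rect_subset (s α : ℝ) : closure (Rect s α) ⊆ Icc (-s) s ×ˢ Icc (-α) α :=
  closure_minimal (prod_mono Ioo_subset_Icc_self Ioo_subset_Icc_self)
    (isClosed_Icc.prod isClosed_Icc)

lemma Rect_subset_inj {s α : ℝ} (hα : α < π) (hs : s < 1) :
    closure (Rect s α) ⊆ Ioi (-1) ×ˢ Ioo (-π) π := by
  intro x hx
  obtain ⟨h1, h2⟩ := closure_Rect_subset s α hx
  simp only [mem_Icc] at h1 h2
  exact ⟨show -1 < x.1 by linarith [h1.1], show -π < x.2 by linarith [h2.1],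
    show x.2 < π by linarith [h2.2]⟩

lemma PP_closure {s α : ℝ} {x : ℝ × ℝ} (hx : x ∈ closure (Rect s α)) :
    PP x ∈ closure (Omega2 α s) := by
  rw [Omega2_eq]
  exact image_closure_subset_closure_image PP_continuous ⟨x, hx, rfl⟩

lemma PP_frontier {s α : ℝ} (hα : α < π) (hs : s < 1) {x : ℝ × ℝ}
    (hx : x ∈ closure (Rect s α)) (hx' : x ∉ Rect s α) : PP x ∈ frontier (Omega2 α s) := by
  rw [(isOpen_Omega2 hα hs).frontier_eq]
  refine ⟨PP_closure hx, ?_⟩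
  rw [Omega2_eq]
  rintro ⟨y, hy, hyx⟩
  have := PP_injOn (Rect_subset_inj hα hs (subset_closure hy)) (Rect_subset_inj hα hs hx) hyx
  exact hx' (this ▸ hy)

open Classical in
/-- The function in polar coordinates, extended by zero. -/
def vv (s α : ℝ) (u : ℂ → ℝ) (x : ℝ × ℝ) : ℝ := if x ∈ Rect s α then u (PP x) else 0

lemma vv_of_mem {s α : ℝ} {u : ℂ → ℝ} {x : ℝ × ℝ} (hx : x ∈ Rect s α) :
    vv s α u x = u (PP x) := if_pos hx

lemma vv_of_notMem {s α : ℝ} {u : ℂ → ℝ} {x : ℝ × ℝ} (hx : x ∉ Rect s α) :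
    vv s α u x = 0 := if_neg hx

lemma vv_continuous {s α : ℝ} (hα : α < π) (hs : s < 1) {u : ℂ → ℝ}
    (hu : ContinuousOn u (closure (Omega2 α s))) (hb : ∀ z ∈ frontier (Omega2 α s), u z = 0) :
    Continuous (vv s α u) := by
  have h1 : ContinuousOn (vv s α u) (closure (Rect s α)) := by
    have : ContinuousOn (fun x => u (PP x)) (closure (Rect s α)) :=
      hu.comp PP_continuous.continuousOn (fun x hx => PP_closure hx)
    refine this.congr fun x hx => ?_
    by_cases hx' : x ∈ Rect s α
    · exact vv_of_mem hx'
    · exact (vv_of_notMem hx').trans (hb _ (PP_frontier hα hs hx hx')).symm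
  have h2 : ContinuousOn (vv s α u) (Rect s α)ᶜ :=
    (continuousOn_const (c := (0:ℝ))).congr fun x hx => vv_of_notMem hx
  have h3 := h1.union_of_isClosed h2 isClosed_closure (isOpen_Rect s α).isClosed_compl
  have : closure (Rect s α) ∪ (Rect s α)ᶜ = univ := by
    rw [eq_univ_iff_forall]
    intro x
    by_cases hx' : x ∈ Rect s α
    · exact Or.inl (subset_closure hx')
    · exact Or.inr hx'
  rw [this] at h3
  exact continuousOn_univ.1 h3

lemma PP_mem {s α : ℝ} {x : ℝ × ℝ} (hx : x ∈ Rect s α) : PP x ∈ Omega2 α s := by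
  rw [Omega2_eq]; exact ⟨x, hx, rfl⟩

lemma vv_contDiffOn {s α : ℝ} {u : ℂ → ℝ} (hu : ContDiffOn ℝ 1 u (Omega2 α s)) :
    ContDiffOn ℝ 1 (vv s α u) (Rect s α) :=
  (hu.comp PP_contDiff.contDiffOn (fun _ hx => PP_mem hx)).congr fun _ hx => vv_of_mem hx

lemma vv_gw {s α : ℝ} (hα : α < π) (hs : s < 1) {u : ℂ → ℝ}
    (hu : ContDiffOn ℝ 1 u (Omega2 α s)) {x : ℝ × ℝ} (hx : x ∈ Rect s α) :
    gw (vv s α u) x =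
      ⟨Real.cos x.2 * (grad u (PP x)).re + Real.sin x.2 * (grad u (PP x)).im,
        -Real.sin x.2 * (grad u (PP x)).re + Real.cos x.2 * (grad u (PP x)).im⟩ := by
  have hd : DifferentiableAt ℝ u (PP x) :=
    (hu.contDiffAt ((isOpen_Omega2 hα hs).mem_nhds (PP_mem hx))).differentiableAt one_ne_zero
  obtain ⟨L, hL, L1, L2⟩ := PP_hasFDerivAt x
  have hv : HasFDerivAt (vv s α u) ((fderiv ℝ u (PP x)).comp L) x := by
    refine (hd.hasFDerivAt.comp x hL).congr_of_eventuallyEq ?_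
    filter_upwards [(isOpen_Rect s α).mem_nhds hx] with y hy using vv_of_mem hy
  have hr : 1 + x.1 ≠ 0 := by
    have := hx.1.1
    linarith
  unfold gw grad
  rw [hv.fderiv]
  simp only [ContinuousLinearMap.comp_apply, L1, L2, map_add, map_smul, smul_eq_mul]
  congr 1
  field_simp

lemma vv_norm {s α : ℝ} (hα : α < π) (hs : s < 1) {u : ℂ → ℝ}
    (hu : ContDiffOn ℝ 1 u (Omega2 α s)) {x : ℝ × ℝ} (hx : x ∈ Rect s α) :
    ‖gw (vv s α u) x‖ = ‖grad u (PP x)‖ := by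
  rw [vv_gw hα hs hu hx, Complex.norm_def, Complex.norm_def, Complex.normSq_apply,
    Complex.normSq_apply]
  congr 1
  simp only
  linear_combination ((grad u (PP x)).re ^ 2 + (grad u (PP x)).im ^ 2) *
    Real.sin_sq_add_cos_sq x.2

/-- The radial component of the field. -/
def W1 (A : ℂ → ℂ) (x : ℝ × ℝ) : ℝ :=
  (1 + x.1) * (Real.cos x.2 * (A (PP x)).re + Real.sin x.2 * (A (PP x)).im)

/-- The angular component of the field. -/
def W2 (A : ℂ → ℂ) (x : ℝ × ℝ) : ℝ :=
  -Real.sin x.2 * (A (PP x)).re + Real.cos x.2 * (A (PP x)).im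

lemma comp_parts {A : ℂ → ℂ} {s α : ℝ} (hA : ContDiffOn ℝ 1 A (Omega2 α s)) :
    ContDiffOn ℝ 1 (fun x => (A (PP x)).re) (Rect s α) ∧
    ContDiffOn ℝ 1 (fun x => (A (PP x)).im) (Rect s α) := by
  have h : ContDiffOn ℝ 1 (fun x => A (PP x)) (Rect s α) :=
    hA.comp PP_contDiff.contDiffOn (fun _ hx => PP_mem hx)
  exact ⟨Complex.reCLM.contDiff.comp_contDiffOn h, Complex.imCLM.contDiff.comp_contDiffOn h⟩

lemma W1_contDiffOn {A : ℂ → ℂ} {s α : ℝ} (hA : ContDiffOn ℝ 1 A (Omega2 α s)) :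
    ContDiffOn ℝ 1 (W1 A) (Rect s α) := by
  obtain ⟨h1, h2⟩ := comp_parts hA
  unfold W1
  fun_prop

lemma W2_contDiffOn {A : ℂ → ℂ} {s α : ℝ} (hA : ContDiffOn ℝ 1 A (Omega2 α s)) :
    ContDiffOn ℝ 1 (W2 A) (Rect s α) := by
  obtain ⟨h1, h2⟩ := comp_parts hA
  unfold W2
  fun_prop

lemma W_div {A : ℂ → ℂ} {x : ℝ × ℝ} (hA : DifferentiableAt ℝ A (PP x)) :
    fderiv ℝ (W1 A) x (1, 0) + fderiv ℝ (W2 A) x (0, 1) = (1 + x.1) * divg A (PP x) := by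
  obtain ⟨L, hL, L1, L2⟩ := PP_hasFDerivAt x
  have hB := hA.hasFDerivAt.comp x hL
  have hre : HasFDerivAt (fun y => (A (PP y)).re)
      (Complex.reCLM.comp ((fderiv ℝ A (PP x)).comp L)) x :=
    Complex.reCLM.hasFDerivAt.comp x hB
  have him : HasFDerivAt (fun y => (A (PP y)).im)
      (Complex.imCLM.comp ((fderiv ℝ A (PP x)).comp L)) x :=
    Complex.imCLM.hasFDerivAt.comp x hB
  have h1 : HasFDerivAt (fun y : ℝ × ℝ => 1 + y.1) (ContinuousLinearMap.fst ℝ ℝ ℝ) x :=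
    hasFDerivAt_fst.const_add 1
  have hc : HasFDerivAt (fun y : ℝ × ℝ => Real.cos y.2)
      ((-Real.sin x.2) • ContinuousLinearMap.snd ℝ ℝ ℝ) x := hasFDerivAt_snd.cos
  have hs : HasFDerivAt (fun y : ℝ × ℝ => Real.sin y.2)
      (Real.cos x.2 • ContinuousLinearMap.snd ℝ ℝ ℝ) x := hasFDerivAt_snd.sin
  have e1 : HasFDerivAt (W1 A) _ x := h1.mul ((hc.mul hre).add (hs.mul him))
  have e2 : HasFDerivAt (W2 A) _ x := (hs.neg.mul hre).add (hc.mul him)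
  have l1 : fderiv ℝ A (PP x) (L (1, 0)) = Real.cos x.2 • fderiv ℝ A (PP x) 1 +
      Real.sin x.2 • fderiv ℝ A (PP x) Complex.I := by rw [L1, map_add, map_smul, map_smul]
  have l2 : fderiv ℝ A (PP x) (L (0, 1)) =
      (-((1 + x.1) * Real.sin x.2)) • fderiv ℝ A (PP x) 1 +
      ((1 + x.1) * Real.cos x.2) • fderiv ℝ A (PP x) Complex.I := by
    rw [L2, map_add, map_smul, map_smul]
  rw [e1.fderiv, e2.fderiv]
  simp only [ContinuousLinearMap.add_apply, ContinuousLinearMap.smul_apply,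
    ContinuousLinearMap.neg_apply, ContinuousLinearMap.comp_apply, l1, l2, divg,
    Complex.reCLM_apply, Complex.imCLM_apply, Complex.add_re, Complex.add_im, Complex.smul_re,
    Complex.smul_im, smul_eq_mul, ContinuousLinearMap.coe_fst', ContinuousLinearMap.coe_snd',
    Pi.neg_apply]
  linear_combination ((1 + x.1) * ((fderiv ℝ A (PP x) 1).re + (fderiv ℝ A (PP x) Complex.I).im)) *
    Real.sin_sq_add_cos_sq x.2

lemma int_transfer {s α : ℝ} (hα : α < π) (hs : s < 1) {g : ℂ → ℝ}
    (hg : IntegrableOn g (Omega2 α s)) :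
    IntegrableOn (fun x => (1 + x.1) * g (PP x)) (Rect s α) := by
  rw [← (Complex.volume_preserving_equiv_real_prod.symm _).integrableOn_comp_preimage
    (MeasurableEquiv.measurableEmbedding _)] at hg
  set f : ℝ × ℝ → ℝ × ℝ := fun x => polarCoord.symm (x + (1, 0)) with hf
  have hfP : ∀ x, Complex.measurableEquivRealProd.symm (f x) = PP x := by
    intro x
    rw [PP_eq_polar, hf]
    simp only
    rw [Complex.measurableEquivRealProd_symm_polarCoord_symm_apply]
    congr 1
    ext <;> simp [add_comm]
  have himg : Complex.measurableEquivRealProd.symm ⁻¹' (Omega2 α s) = f '' Rect s α := by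
    rw [Omega2_eq]
    ext y
    constructor
    · rintro ⟨x, hx, hxy⟩
      refine ⟨x, hx, Complex.measurableEquivRealProd.symm.injective ?_⟩
      rw [hfP, hxy]
    · rintro ⟨x, hx, rfl⟩
      exact ⟨x, hx, (hfP x).symm⟩
  rw [himg] at hg
  have hder : ∀ x ∈ Rect s α,
      HasFDerivWithinAt f (fderivPolarCoordSymm (x + (1, 0))) (Rect s α) x := by
    intro x _
    have := (hasFDerivAt_polarCoord_symm (x + (1, 0))).comp x
      ((hasFDerivAt_id (𝕜 := ℝ) x).add_const ((1:ℝ), (0:ℝ)))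
    rw [ContinuousLinearMap.comp_id] at this
    exact this.hasFDerivWithinAt
  have hinj : InjOn f (Rect s α) := by
    intro x hx y hy hxy
    apply PP_injOn (Rect_subset_inj hα hs (subset_closure hx))
      (Rect_subset_inj hα hs (subset_closure hy))
    rw [← hfP, ← hfP, hxy]
  rw [integrableOn_image_iff_integrableOn_abs_det_fderiv_smul volume (measurableSet_Rect s α)
    hder hinj] at hg
  refine hg.congr_fun (fun x hx => ?_) (measurableSet_Rect s α)
  have h1 : -s < x.1 := hx.1.1
  simp only [det_fderivPolarCoordSymm, Function.comp, smul_eq_mul]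
  rw [hfP]
  congr 1
  rw [abs_of_pos] <;> simp <;> linarith

lemma rectSol_of_classical {p q κ s α : ℝ} {u : ℂ → ℝ} (hp1 : 1 < p) (hp2 : p < 2) (hq : 2 < q)
    (hs0 : 0 < s) (hs1 : s < 1) (hα0 : 0 < α) (hα : α < π) (hκ0 : 0 < κ) (hκ1 : κ < 1)
    (hκ : ∀ r, |r| < s → |r| ≤ κ * (1 + r))
    (hu : IsClassicalSolution p (fun t => |t| ^ (q - 2) * t) (Omega2 α s) u) :
    RectSol p q κ s α (vv s α u)
      (W1 (fun z => (‖grad u z‖ ^ (p - 2) : ℝ) • grad u z))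
      (W2 (fun z => (‖grad u z‖ ^ (p - 2) : ℝ) • grad u z)) where
  hp1 := hp1
  hp2 := hp2
  hq := hq
  hs0 := hs0
  hs1 := hs1
  hα := hα0
  hκ0 := hκ0
  hκ1 := hκ1
  hκ := hκ
  cont := vv_continuous hα hs1 hu.contOn hu.boundary
  zero := fun x hx => vv_of_notMem hx
  cd := vv_contDiffOn hu.contDiffOn
  V1cd := W1_contDiffOn hu.fieldContDiffOn
  V2cd := W2_contDiffOn hu.fieldContDiffOn
  V1eq := by
    intro x hx
    rw [vv_norm hα hs1 hu.contDiffOn hx, vv_gw hα hs1 hu.contDiffOn hx]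
    simp only [W1, Complex.smul_re, Complex.smul_im, smul_eq_mul]
    ring
  V2eq := by
    intro x hx
    rw [vv_norm hα hs1 hu.contDiffOn hx, vv_gw hα hs1 hu.contDiffOn hx]
    simp only [W2, Complex.smul_re, Complex.smul_im, smul_eq_mul]
    ring
  div := by
    intro x hx
    rw [W_div ((hu.fieldContDiffOn.contDiffAt
      ((isOpen_Omega2 hα hs1).mem_nhds (PP_mem hx))).differentiableAt one_ne_zero)]
    have := hu.pde (PP x) (PP_mem hx)
    rw [vv_of_mem hx, eq_neg_of_add_eq_zero_left this, pf]
    ring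
  int := by
    refine (int_transfer hα hs1 hu.integrable).congr_fun (fun x hx => ?_) (measurableSet_Rect s α)
    simp only
    rw [vv_norm hα hs1 hu.contDiffOn hx]

/-- Nonexistence of nontrivial solutions of `div(|∇u|^{p-2}∇u) + |u|^{q-2}u = 0`
in `Ω₂^{α,s}`, for `s` small, uniformly in `α ∈ (0, π)`. -/
theorem nonexistence_pure_power (p : ℝ) (hp1 : 1 < p) (hp2 : p < 2)
    (q : ℝ) (hq : 2 * p / (2 - p) < q) :
    ∃ sbar : ℝ, sbar ∈ Set.Ioo (0:ℝ) 1 ∧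
      ∀ α ∈ Set.Ioo (0:ℝ) π, ∀ s ∈ Set.Ioo (0:ℝ) sbar,
        ∀ u : ℂ → ℝ,
          IsClassicalSolution p (fun t => |t| ^ (q - 2) * t) (Omega2 α s) u →
          ∀ z ∈ Omega2 α s, u z = 0 := by
  have hp0 : 0 < p := by linarith
  have h2p : 0 < 2 - p := by linarith
  have hq2 : 2 < q := by
    refine lt_trans ?_ hq
    rw [lt_div_iff₀ h2p]
    linarith
  have hq0 : 0 < q := by linarith
  have hneg : (p - 2) / p + 2 / q < 0 := by
    rw [div_lt_iff₀ h2p] at hq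
    rw [div_add_div _ _ hp0.ne' hq0.ne']
    apply div_neg_of_neg_of_pos _ (by positivity)
    linarith
  obtain ⟨c, hc⟩ : ∃ c, c = (p - 2) / p + 2 / q := ⟨_, rfl⟩
  obtain ⟨d, hd⟩ : ∃ d, d = (1 + p) / p + 1 / q := ⟨_, rfl⟩
  have hd0 : 0 < d := by rw [hd]; positivity
  rw [← hc] at hneg
  obtain ⟨κ, hκ0, hκ1, hκ⟩ : ∃ κ : ℝ, 0 < κ ∧ κ < 1 ∧ c + κ * d < 0 := by
    refine ⟨min (1 / 2) (-c / (2 * d)), ?_, ?_, ?_⟩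
    · exact lt_min (by norm_num) (div_pos (by linarith) (by linarith))
    · exact lt_of_le_of_lt (min_le_left _ _) (by norm_num)
    · have h1 : min (1 / 2) (-c / (2 * d)) * d ≤ -c / (2 * d) * d :=
        mul_le_mul_of_nonneg_right (min_le_right _ _) hd0.le
      have h2 : -c / (2 * d) * d = -c / 2 := by field_simp
      linarith
  have hcond : (κ + p * (1 + κ) - 2) / p + (2 + κ) / q < 0 := by
    have : (κ + p * (1 + κ) - 2) / p + (2 + κ) / q = c + κ * d := by
      rw [hc, hd]; field_simp; ring
    rw [this]; exact hκ
  refine ⟨κ / (1 + κ), ⟨by positivity, ?_⟩, ?_⟩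
  · rw [div_lt_one (by linarith)]; linarith
  intro α hα s hs u hu z hz
  have hsk : s * (1 + κ) < κ := (lt_div_iff₀ (by linarith)).1 hs.2
  have hs1 : s < 1 := by nlinarith [hs.1]
  have hr : ∀ r, |r| < s → |r| ≤ κ * (1 + r) := by
    intro r hr
    have h1 : -|r| ≤ r := neg_abs_le r
    nlinarith
  have hR := rectSol_of_classical hp1 hp2 hq2 hs.1 hs1 hα.1 hα.2 hκ0 hκ1 hr hu
  rw [Omega2_eq] at hz
  obtain ⟨x, hx, rfl⟩ := hz
  rw [← vv_of_mem (s := s) (α := α) (u := u) hx]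
  exact hR.conclusion hcond x hx
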